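/- Let Φ_1,…,Φ_n be strictly increasing growth functions on [0,∞), and let Φ be a one-to-one correspondence from [0,∞) to itself such that Φ^{-1} = Φ_1^{-1}·…·Φ_n^{-1}. If each Φ_i satisfies the Δ'-condition, then Φ satisfies the Δ'-condition. -/

import Mathlib

open MeasureTheory Set
open scoped BigOperators ENNReal NNReal

noncomputable section

namespace TwoWeight

/-- A cube in `ℝ^d` with sides parallel to the coordinate axes and sidelength `l > 0`. -/
def IsCubeL {d : ℕ} (Q : Set (Fin d → ℝ)) (l : ℝ) : Prop :=
  0 < l ∧ ∃ c : Fin d → ℝ, Q = Set.univ.pi fun i => Set.Ico (c i) (c i + l)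

/-- A nondegenerate axis-parallel cube. -/
def IsCube {d : ℕ} (Q : Set (Fin d → ℝ)) : Prop :=
  ∃ l : ℝ, IsCubeL Q l

/-- `σ(E) = ∫_E σ`. -/
def wMeas {d : ℕ} (σ : (Fin d → ℝ) → ℝ) (E : Set (Fin d → ℝ)) : ℝ :=
  ∫ x in E, σ x

/-- A weight: a positive locally integrable function. -/
def IsWeight {d : ℕ} (σ : (Fin d → ℝ) → ℝ) : Prop :=
  (∀ x, 0 < σ x) ∧ LocallyIntegrable σ volume

/-- A doubling weight. -/
def DoublingWeight {d : ℕ} (σ : (Fin d → ℝ) → ℝ) : Prop :=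
  ∃ C > 1, ∀ (Q Q' : Set (Fin d → ℝ)) (l l' : ℝ),
    IsCubeL Q l → IsCubeL Q' l' → Q ⊆ Q' → l' ≤ 2 * l →
      wMeas σ Q' ≤ C * wMeas σ Q

/-- Growth function: a continuous nondecreasing surjection of `[0,∞)` onto itself,
not identically zero. -/
def GrowthFun (Φ : ℝ → ℝ) : Prop :=
  ContinuousOn Φ (Ici 0) ∧ MonotoneOn Φ (Ici 0) ∧ SurjOn Φ (Ici 0) (Ici 0) ∧
    ∃ t ∈ Ici (0 : ℝ), Φ t ≠ 0

/-- The `Δ'` condition. -/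
def DeltaPrime (Φ : ℝ → ℝ) : Prop :=
  ∃ C > 0, ∀ s > 0, ∀ t > 0, Φ (s * t) ≤ C * Φ s * Φ t

/-- The `Δ₂` condition. -/
def Delta2 (Φ : ℝ → ℝ) : Prop :=
  ∃ K > 0, ∀ t > 0, Φ (2 * t) ≤ K * Φ t

/-- Upper type `q`. -/
def UpperType (q : ℝ) (Φ : ℝ → ℝ) : Prop :=
  ∃ C > 0, ∀ s > 0, ∀ t ≥ (1 : ℝ), Φ (s * t) ≤ C * t ^ q * Φ s

/-- The class `𝒰^q`: growth functions of upper type `q ≥ 1` with `t ↦ Φ(t)/t`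
nondecreasing on `(0,∞)`. -/
def ClassUq (q : ℝ) (Φ : ℝ → ℝ) : Prop :=
  GrowthFun Φ ∧ 1 ≤ q ∧ UpperType q Φ ∧ MonotoneOn (fun t => Φ t / t) (Ioi 0)

/-- The class `𝒰`. -/
def ClassU (Φ : ℝ → ℝ) : Prop := ∃ q, ClassUq q Φ

/-- The class `𝒰̃^q`. -/
def ClassUtq (q : ℝ) (Φ : ℝ → ℝ) : Prop :=
  ClassUq q Φ ∧ DeltaPrime Φ ∧
    ∃ C > 0, ∀ s ≥ (1 : ℝ), ∀ t ≥ (1 : ℝ), Φ (s / t) ≤ C * Φ s / t ^ q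

/-- The class `𝒰̃`. -/
def ClassUt (Φ : ℝ → ℝ) : Prop := ∃ q, ClassUtq q Φ

/-- The `∇₂` condition (for convex growth functions satisfying `Δ₂`). -/
def Nabla2 (Φ : ℝ → ℝ) : Prop :=
  ConvexOn ℝ (Ici 0) Φ ∧ Delta2 Φ ∧
    ∃ C > 0, ∀ t > 0, (∫ s in Ioo (0 : ℝ) t, Φ s / s ^ 2) ≤ C * Φ t / t

/-- The inverse of `Φ` on `[0,∞)`. -/
def oInv (Φ : ℝ → ℝ) : ℝ → ℝ := Function.invFunOn Φ (Ici 0)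

/-- Luxemburg norm of `f` in the weighted Orlicz space `L^Φ(σ)`. -/
def luxNorm {d : ℕ} (Φ : ℝ → ℝ) (σ f : (Fin d → ℝ) → ℝ) : ℝ :=
  sInf {lam : ℝ | 0 < lam ∧
    Integrable (fun x => Φ (|f x| / lam) * σ x) volume ∧
    (∫ x, Φ (|f x| / lam) * σ x) ≤ 1}

/-- Membership in the weighted Orlicz space `L^Φ(σ)`. -/
def MemOrlicz {d : ℕ} (Φ : ℝ → ℝ) (σ f : (Fin d → ℝ) → ℝ) : Prop :=
  Measurable f ∧ ∃ lam : ℝ, 0 < lam ∧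
    Integrable (fun x => Φ (|f x| / lam) * σ x) volume ∧
    (∫ x, Φ (|f x| / lam) * σ x) ≤ 1

/-- The average `m_σ(f,Q) = (1/σ(Q)) ∫_Q |f| σ`. -/
def mAvg {d : ℕ} (σ f : (Fin d → ℝ) → ℝ) (Q : Set (Fin d → ℝ)) : ℝ :=
  (∫ x in Q, |f x| * σ x) / wMeas σ Q

/-- The weighted multilinear Hardy–Littlewood maximal function `M_σ⃗`. -/
def multiMaxW {d n : ℕ} (σ f : Fin n → (Fin d → ℝ) → ℝ) (x : Fin d → ℝ) : ℝ :=
  ⨆ Q : {Q : Set (Fin d → ℝ) // IsCube Q ∧ x ∈ Q}, ∏ i, mAvg (σ i) (f i) Q.1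

/-- A dyadic grid in `ℝ^d`. -/
def IsDyadicGrid {d : ℕ} (𝒟 : Set (Set (Fin d → ℝ))) : Prop :=
  (∀ Q ∈ 𝒟, ∃ k : ℤ, IsCubeL Q ((2 : ℝ) ^ k)) ∧
  (∀ Q ∈ 𝒟, ∀ Q' ∈ 𝒟, Q ∩ Q' = Q ∨ Q ∩ Q' = Q' ∨ Q ∩ Q' = ∅) ∧
  (∀ k : ℤ, ∀ x : Fin d → ℝ, ∃ Q ∈ 𝒟, IsCubeL Q ((2 : ℝ) ^ k) ∧ x ∈ Q)

/-- The dyadic weighted multilinear maximal function `M_σ⃗^{D^β}`. -/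
def multiMaxWD {d n : ℕ} (𝒟 : Set (Set (Fin d → ℝ)))
    (σ f : Fin n → (Fin d → ℝ) → ℝ) (x : Fin d → ℝ) : ℝ :=
  ⨆ Q : {Q : Set (Fin d → ℝ) // Q ∈ 𝒟 ∧ x ∈ Q}, ∏ i, mAvg (σ i) (f i) Q.1

/-- The multilinear fractional maximal function `M_α`. -/
def fracMax {d n : ℕ} (α : ℝ) (f : Fin n → (Fin d → ℝ) → ℝ) (x : Fin d → ℝ) : ℝ :=
  ⨆ Q : {Q : Set (Fin d → ℝ) // IsCube Q ∧ x ∈ Q},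
    (volume Q.1).toReal ^ (α / d) *
      ∏ i, (∫ y in Q.1, |f i y|) / (volume Q.1).toReal

/-- The Hardy–Littlewood maximal function. -/
def hlMax {d : ℕ} (f : (Fin d → ℝ) → ℝ) (x : Fin d → ℝ) : ℝ :=
  ⨆ Q : {Q : Set (Fin d → ℝ) // IsCube Q ∧ x ∈ Q},
    (∫ y in Q.1, |f y|) / (volume Q.1).toReal

/-- The Fujii–Wilson `A_∞` characteristic. -/
def ainftyConst {d : ℕ} (σ : (Fin d → ℝ) → ℝ) : ℝ :=
  sSup {r : ℝ | ∃ Q : Set (Fin d → ℝ), IsCube Q ∧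
    r = (∫ x in Q, hlMax (Q.indicator σ) x) / wMeas σ Q}

/-- Membership in the Fujii–Wilson class `A_∞`. -/
def MemAinfty {d : ℕ} (σ : (Fin d → ℝ) → ℝ) : Prop :=
  BddAbove {r : ℝ | ∃ Q : Set (Fin d → ℝ), IsCube Q ∧
    r = (∫ x in Q, hlMax (Q.indicator σ) x) / wMeas σ Q}

/-- The complementary (conjugate) function of `Φ`. -/
def complFun (Φ : ℝ → ℝ) (s : ℝ) : ℝ :=
  ⨆ t : Ici (0 : ℝ), (s * t.1 - Φ t.1)

end TwoWeight

namespace TwoWeight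

theorem oInv_nonneg {Φ : ℝ → ℝ} (h : SurjOn Φ (Ici 0) (Ici 0)) {t : ℝ} (ht : 0 ≤ t) :
    0 ≤ oInv Φ t :=
  Function.invFunOn_mem (h ht)

theorem apply_oInv {Φ : ℝ → ℝ} (h : SurjOn Φ (Ici 0) (Ici 0)) {t : ℝ} (ht : 0 ≤ t) :
    Φ (oInv Φ t) = t :=
  Function.invFunOn_eq (h ht)

theorem le_oInv {Φ : ℝ → ℝ} (h : SurjOn Φ (Ici 0) (Ici 0)) (hm : StrictMonoOn Φ (Ici 0))
    {x t : ℝ} (hx : 0 ≤ x) (ht : 0 ≤ t) (hxt : Φ x ≤ t) : x ≤ oInv Φ t :=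
  (hm.le_iff_le hx (oInv_nonneg h ht)).1 (by rwa [apply_oInv h ht])

theorem oInv_mul_oInv_le {Φ : ℝ → ℝ} (h : SurjOn Φ (Ici 0) (Ici 0))
    (hm : StrictMonoOn Φ (Ici 0)) {C a b : ℝ} (hC : 0 ≤ C) (ha : 0 ≤ a) (hb : 0 ≤ b)
    (hΔ : ∀ s > 0, ∀ t > 0, Φ (s * t) ≤ C * Φ s * Φ t) :
    oInv Φ a * oInv Φ b ≤ oInv Φ (C * a * b) := by
  have hx := oInv_nonneg h ha
  have hy := oInv_nonneg h hb
  have hc : 0 ≤ C * a * b := by positivity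
  rcases hx.eq_or_lt with hx0 | hx0
  · simpa [← hx0] using oInv_nonneg h hc
  rcases hy.eq_or_lt with hy0 | hy0
  · simpa [← hy0] using oInv_nonneg h hc
  refine le_oInv h hm (mul_nonneg hx hy) hc ?_
  simpa only [apply_oInv h ha, apply_oInv h hb] using hΔ _ hx0 _ hy0

/-- if each `Φᵢ` satisfies `Δ'`, so does `Φ` with
`Φ⁻¹ = Φ₁⁻¹⋯Φₙ⁻¹` (Proposition `pro:main55`). -/
theorem deltaPrime_of_components {n : ℕ}
    (Φi : Fin n → ℝ → ℝ)
    (hΦi : ∀ i, GrowthFun (Φi i) ∧ StrictMonoOn (Φi i) (Ici 0))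
    (Φ : ℝ → ℝ) (hΦ : Set.BijOn Φ (Ici 0) (Ici 0))
    (hΦinv : ∀ t ≥ (0 : ℝ), oInv Φ t = ∏ i, oInv (Φi i) t)
    (hdp : ∀ i, DeltaPrime (Φi i)) :
    DeltaPrime Φ := by
  have hsurj : ∀ i, SurjOn (Φi i) (Ici 0) (Ici 0) := fun i => (hΦi i).1.2.2.1
  have hmono : ∀ {u v : ℝ}, 0 ≤ u → u ≤ v → ∀ i, oInv (Φi i) u ≤ oInv (Φi i) v :=
    fun hu huv i => le_oInv (hsurj i) (hΦi i).2 (oInv_nonneg (hsurj i) hu) (hu.trans huv)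
      (by rwa [apply_oInv (hsurj i) hu])
  have hprod : ∀ {u v : ℝ}, 0 ≤ u → u ≤ v → oInv Φ u ≤ oInv Φ v := fun {u v} hu huv => by
    rw [hΦinv u hu, hΦinv v (hu.trans huv)]
    exact Finset.prod_le_prod (fun i _ => oInv_nonneg (hsurj i) hu) fun i _ => hmono hu huv i
  choose C hC hΔ using hdp
  have hsum : 0 ≤ ∑ i, C i := Finset.sum_nonneg fun i _ => (hC i).le
  refine ⟨1 + ∑ i, C i, by positivity, fun s hs t ht => ?_⟩
  have ha : 0 ≤ Φ s := hΦ.mapsTo hs.le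
  have hb : 0 ≤ Φ t := hΦ.mapsTo ht.le
  have hst : 0 ≤ s * t := by positivity
  have hc : 0 ≤ (1 + ∑ i, C i) * Φ s * Φ t := by positivity
  have hleft : ∀ x ≥ 0, oInv Φ (Φ x) = x := fun x hx => hΦ.injOn.leftInvOn_invFunOn hx
  have hle : s * t ≤ oInv Φ ((1 + ∑ i, C i) * Φ s * Φ t) := by
    calc s * t = ∏ i, oInv (Φi i) (Φ s) * oInv (Φi i) (Φ t) := by
          rw [Finset.prod_mul_distrib, ← hΦinv _ ha, ← hΦinv _ hb, hleft s hs.le, hleft t ht.le]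
      _ ≤ ∏ i, oInv (Φi i) ((1 + ∑ i, C i) * Φ s * Φ t) := by
          refine Finset.prod_le_prod (fun i _ => mul_nonneg (oInv_nonneg (hsurj i) ha)
            (oInv_nonneg (hsurj i) hb)) fun i _ => ?_
          have hCi : C i ≤ 1 + ∑ j, C j :=
            (Finset.single_le_sum (fun j _ => (hC j).le) (Finset.mem_univ i)).trans (by linarith)
          have hCi0 := (hC i).le
          exact (oInv_mul_oInv_le (hsurj i) (hΦi i).2 hCi0 ha hb (hΔ i)).trans
            (hmono (by positivity) (by gcongr) i)
      _ = _ := (hΦinv _ hc).symm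
  by_contra! hlt
  have hge := hprod hc hlt.le
  rw [hleft _ hst] at hge
  rw [hle.antisymm hge, apply_oInv hΦ.surjOn hc] at hlt
  exact hlt.false

end TwoWeight
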